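/- arXiv:1602.01357 — 3 statements merged into one kernel-verified Lean document; each statement's English description precedes it below -/
import Mathlib

section
/- With ξ, A₀ and δ = (1/2)log(1/λ) as in the context, write ‖ξ''‖_∞ = sup_{t≥0} |ξ''(t)|. Then for every λ ∈ (0,1): ∫_{λ ≤ ‖x‖ ≤ √λ} ‖x‖⁻⁴·( δ⁻¹·ξ''(δ⁻¹ log(1/‖x‖)) − 2·ξ'(δ⁻¹ log(1/‖x‖)) )² dx ≤ 4π²·( ‖ξ''‖_∞² / log(1/λ) + 2·A₀·‖ξ''‖_∞ + A₀²·log(1/λ) ). -/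
open Real MeasureTheory

lemma integrableOn_annulus_inv_norm_pow_four {a b : ℝ} (ha : 0 < a) :
    IntegrableOn (fun x : EuclideanSpace ℝ (Fin 4) => (‖x‖ ^ 4)⁻¹)
      {x | a ≤ ‖x‖ ∧ ‖x‖ ≤ b} := by
  have hc : IsCompact {x : EuclideanSpace ℝ (Fin 4) | a ≤ ‖x‖ ∧ ‖x‖ ≤ b} := by
    refine (isCompact_closedBall (0 : EuclideanSpace ℝ (Fin 4)) b).of_isClosed_subset ?_ ?_
    · exact (isClosed_le continuous_const continuous_norm).inter
        (isClosed_le continuous_norm continuous_const)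
    · intro x hx
      simpa using hx.2
  refine ContinuousOn.integrableOn_compact hc ?_
  refine ContinuousOn.inv₀ (by fun_prop) fun x hx => ?_
  have : 0 < ‖x‖ := ha.trans_le hx.1
  positivity

lemma setIntegral_annulus_inv_norm_pow_four {a b : ℝ} (ha : 0 < a) (hab : a ≤ b) :
    ∫ x in {x : EuclideanSpace ℝ (Fin 4) | a ≤ ‖x‖ ∧ ‖x‖ ≤ b}, (‖x‖ ^ 4)⁻¹ =
      2 * π ^ 2 * Real.log (b / a) := by
  have hball : (volume : Measure (EuclideanSpace ℝ (Fin 4))).real (Metric.ball 0 1) =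
      π ^ 2 / 2 := by
    rw [measureReal_def, InnerProductSpace.volume_ball_of_dim_even (k := 2) (by simp)]
    simp [Nat.factorial]
    positivity
  have hmeas : MeasurableSet {x : EuclideanSpace ℝ (Fin 4) | a ≤ ‖x‖ ∧ ‖x‖ ≤ b} :=
    (measurableSet_le measurable_const measurable_norm).inter
      (measurableSet_le measurable_norm measurable_const)
  have hrad : ∫ y in Set.Ioi (0 : ℝ),
      y ^ 3 • (Set.Icc a b).indicator (fun r : ℝ => (r ^ 4)⁻¹) y = Real.log (b / a) := by
    have hfun : Set.EqOn (fun y : ℝ => y ^ 3 • (Set.Icc a b).indicator (fun r => (r ^ 4)⁻¹) y)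
        ((Set.Icc a b).indicator fun r => r⁻¹) (Set.Ioi 0) := by
      intro y (hy : 0 < y)
      by_cases h : y ∈ Set.Icc a b
      · simp only [Set.indicator_of_mem h, smul_eq_mul]
        field_simp
      · simp [Set.indicator_of_notMem h]
    have hsub : Set.Icc a b ⊆ Set.Ioi 0 := fun y hy => ha.trans_le hy.1
    rw [setIntegral_congr_fun measurableSet_Ioi hfun, setIntegral_indicator measurableSet_Icc,
      Set.inter_eq_right.mpr hsub, integral_Icc_eq_integral_Ioc,
      ← intervalIntegral.integral_of_le hab, integral_inv_of_pos ha (ha.trans_le hab)]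
  have key := integral_fun_norm_addHaar (volume : Measure (EuclideanSpace ℝ (Fin 4)))
    ((Set.Icc a b).indicator fun r : ℝ => (r ^ 4)⁻¹)
  rw [hball, finrank_euclideanSpace_fin, hrad] at key
  rw [← integral_indicator hmeas]
  refine Eq.trans ?_ (key.trans ?_)
  · rfl
  · simp only [nsmul_eq_mul, smul_eq_mul]
    push_cast
    ring

lemma bddAbove_abs_image_Ici_of_eq_zero {f : ℝ → ℝ} (hf : Continuous f) {a b : ℝ}
    (h : ∀ t, b < t → f t = 0) : BddAbove ((fun t => |f t|) '' Set.Ici a) := by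
  obtain ⟨C, hC⟩ := (isCompact_Icc (a := a) (b := b)).bddAbove_image hf.abs.continuousOn
  refine ⟨max C 0, ?_⟩
  rintro _ ⟨t, ht, rfl⟩
  rcases le_or_gt t b with htb | htb
  · exact le_max_of_le_left (hC ⟨t, ⟨ht, htb⟩, rfl⟩)
  · simp [h t htb]

/-- With `ξ, A₀` and `δ = (1/2)log(1/λ)` as in the paper, and
`‖ξ''‖_∞ = sup_{t ≥ 0} |ξ''(t)|`, for every `λ ∈ (0,1)`:
`∫_{λ ≤ ‖x‖ ≤ √λ} ‖x‖⁻⁴·(δ⁻¹ ξ''(δ⁻¹ log(1/‖x‖)) − 2 ξ'(δ⁻¹ log(1/‖x‖)))² dx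
  ≤ 4π²·(‖ξ''‖_∞²/log(1/λ) + 2 A₀ ‖ξ''‖_∞ + A₀² log(1/λ))`. -/
theorem term_I_estimate
    (A₀ : ℝ) (hA₀ : 1 < A₀)
    (ξ : ℝ → ℝ) (hξ : ContDiff ℝ (⊤ : ℕ∞) ξ)
    (hξ1 : ∀ t ∈ Set.Icc (0 : ℝ) 1, ξ t = t)
    (hξ2 : ∀ t : ℝ, 2 ≤ t → ξ t = 2)
    (hξ3 : ∀ t ∈ Set.Ioo (1 : ℝ) 2, ξ t ∈ Set.Icc (1 : ℝ) 2)
    (hξ4 : ∀ t : ℝ, 0 ≤ t → 0 ≤ deriv ξ t)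
    (hξ5 : ∀ t : ℝ, 0 ≤ t → deriv ξ t ≤ A₀) :
    ∀ l ∈ Set.Ioo (0 : ℝ) 1, ∀ δ M : ℝ,
      δ = (1 / 2) * Real.log (1 / l) →
      M = sSup ((fun t => |deriv (deriv ξ) t|) '' Set.Ici (0 : ℝ)) →
      (∫ x in {x : EuclideanSpace ℝ (Fin 4) | l ≤ ‖x‖ ∧ ‖x‖ ≤ Real.sqrt l},
          (‖x‖ ^ 4)⁻¹ *
            (δ⁻¹ * deriv (deriv ξ) (δ⁻¹ * Real.log (1 / ‖x‖)) -
              2 * deriv ξ (δ⁻¹ * Real.log (1 / ‖x‖))) ^ 2) ≤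
        4 * π ^ 2 *
          (M ^ 2 / Real.log (1 / l) + 2 * A₀ * M + A₀ ^ 2 * Real.log (1 / l)) := by
  rintro l ⟨hl0, hl1⟩ δ M rfl hM
  have hL : 0 < Real.log (1 / l) := Real.log_pos (one_lt_one_div hl0 hl1)
  set L := Real.log (1 / l) with hLdef
  have hcont : Continuous (deriv (deriv ξ)) :=
    (contDiff_infty_iff_deriv.mp (contDiff_infty_iff_deriv.mp hξ).2).2.continuous
  have hzero : ∀ t, 2 < t → deriv (deriv ξ) t = 0 := by
    have h1 : ∀ t, 2 < t → deriv ξ t = 0 := fun t ht => by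
      have : ξ =ᶠ[nhds t] fun _ => 2 := by
        filter_upwards [Ioi_mem_nhds ht] with s hs using hξ2 s (le_of_lt hs)
      simp [this.deriv_eq]
    intro t ht
    have : deriv ξ =ᶠ[nhds t] fun _ => 0 := by
      filter_upwards [Ioi_mem_nhds ht] with s hs using h1 s hs
    simp [this.deriv_eq]
  have hM' : ∀ t, 0 ≤ t → |deriv (deriv ξ) t| ≤ M := fun t ht => by
    rw [hM]
    exact le_csSup (bddAbove_abs_image_Ici_of_eq_zero hcont hzero) ⟨t, ht, rfl⟩
  have hls : l ≤ √l := Real.le_sqrt_of_sq_le (by nlinarith)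
  have hlog : Real.log (√l / l) = L / 2 := by
    rw [Real.log_div (by positivity) hl0.ne', Real.log_sqrt hl0.le, hLdef, one_div,
      Real.log_inv]
    ring
  have hmeas : MeasurableSet {x : EuclideanSpace ℝ (Fin 4) | l ≤ ‖x‖ ∧ ‖x‖ ≤ √l} :=
    (measurableSet_le measurable_const measurable_norm).inter
      (measurableSet_le measurable_norm measurable_const)
  calc
    _ ≤ ∫ x in {x : EuclideanSpace ℝ (Fin 4) | l ≤ ‖x‖ ∧ ‖x‖ ≤ √l},
          (‖x‖ ^ 4)⁻¹ * (2 / L * M + 2 * A₀) ^ 2 := by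
      refine integral_mono_of_nonneg (Filter.Eventually.of_forall fun x => by positivity)
        ((integrableOn_annulus_inv_norm_pow_four hl0).mul_const _) ?_
      refine (ae_restrict_iff' hmeas).mpr (Filter.Eventually.of_forall fun x hx => ?_)
      have hx0 : 0 < ‖x‖ := hl0.trans_le hx.1
      have hx1 : ‖x‖ ≤ 1 := hx.2.trans (Real.sqrt_le_one.mpr hl1.le)
      have ht : 0 ≤ (1 / 2 * L)⁻¹ * Real.log (1 / ‖x‖) :=
        mul_nonneg (by positivity) (Real.log_nonneg (one_le_one_div hx0 hx1))
      have hinv : (1 / 2 * L)⁻¹ = 2 / L := by field_simp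
      dsimp only
      gcongr (‖x‖ ^ 4)⁻¹ * ?_
      refine sq_le_sq' ?_ ?_ <;>
      · have h2 := abs_le.mp (hM' _ ht)
        have h3 := hξ4 _ ht
        have h4 := hξ5 _ ht
        rw [hinv] at *
        have hp : 0 < 2 / L := by positivity
        have := mul_le_mul_of_nonneg_left h2.1 hp.le
        have := mul_le_mul_of_nonneg_left h2.2 hp.le
        linarith
    _ = _ := by
      rw [integral_mul_const, setIntegral_annulus_inv_norm_pow_four hl0 hls, hlog]
      field_simp
      ring
end

section
/- Let μ₀ > 0 and let c : (0, μ₀] → ℝ be a non-increasing function. Suppose that for every K > 32π² there exists λ_K ∈ (0, μ₀) such that c(μ) ≤ K·log(1/μ) for all μ ∈ (0, λ_K). Then liminf_{μ ↓ 0} μ·|c'(μ)| ≤ 32π², in the following precise sense: for every K > 32π² and every ε > 0 there exists μ ∈ (0, ε) at which c is differentiable and μ·|c'(μ)| ≤ K. -/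
open Real

/-- If `c` is non-increasing on `[a, b]` with `0 < a`, and `K ≤ x·|c'(x)|` at every interior point
of differentiability, then `c` drops by at least `K log (b / a)` between `a` and `b`. -/
lemma AntitoneOn.mul_log_sub_log_le {c : ℝ → ℝ} {a b K : ℝ} (ha : 0 < a) (hab : a ≤ b)
    (hc : AntitoneOn c (Set.Icc a b))
    (hK : ∀ x ∈ Set.Ioo a b, DifferentiableAt ℝ c x → K ≤ x * |deriv c x|) :
    K * (log b - log a) ≤ c a - c b := by
  have hf : MonotoneOn (-c) (Set.uIcc a b) := by
    rw [Set.uIcc_of_le hab]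
    exact hc.neg
  have hderiv : ∫ x in a..b, deriv (-c) x ≤ c a - c b := by
    have h := hf.intervalIntegral_deriv_mem_uIcc
    have hle : c b ≤ c a := hc (Set.left_mem_Icc.2 hab) (Set.right_mem_Icc.2 hab) hab
    rw [Set.uIcc_of_le (by simp only [Pi.neg_apply]; linarith)] at h
    have := h.2
    simp only [Pi.neg_apply] at this
    linarith
  have hlog : ∫ x in a..b, K * x⁻¹ = K * (log b - log a) := by
    rw [intervalIntegral.integral_const_mul, integral_inv_of_pos ha (ha.trans_le hab),
      log_div (ha.trans_le hab).ne' ha.ne']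
  have hint : IntervalIntegrable (fun x : ℝ => K * x⁻¹) MeasureTheory.volume a b := by
    refine (intervalIntegral.intervalIntegrable_inv (fun x hx => ?_) continuousOn_id).const_mul K
    rw [Set.uIcc_of_le hab] at hx
    exact (ha.trans_le hx.1).ne'
  rw [← hlog]
  refine le_trans (intervalIntegral.integral_mono_ae_restrict hab hint
    hf.intervalIntegrable_deriv ?_) hderiv
  rw [← MeasureTheory.restrict_Ioo_eq_restrict_Icc]
  have hIoo := hc.mono Set.Ioo_subset_Icc_self
  have hae := hIoo.neg.ae_differentiableWithinAt measurableSet_Ioo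
  filter_upwards [hae, MeasureTheory.ae_restrict_mem measurableSet_Ioo] with x hx hxm
  have hnhds : Set.Ioo a b ∈ nhds x := isOpen_Ioo.mem_nhds hxm
  have hdiff : DifferentiableAt ℝ c x := by
    simpa using (hx.differentiableAt hnhds).neg
  have hnonpos : deriv c x ≤ 0 := by
    rw [← derivWithin_of_mem_nhds hnhds]
    exact hIoo.derivWithin_nonpos
  have hx0 : 0 < x := ha.trans hxm.1
  have h := hK x hxm hdiff
  rw [abs_of_nonpos hnonpos] at h
  have hneg : deriv (-c) x = -deriv c x := by simp
  rw [hneg, ← div_eq_mul_inv, div_le_iff₀ hx0]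
  linarith

/-- If `c : (0, μ₀] → ℝ` is non-increasing and satisfies `c(μ) ≤ K log(1/μ)` for small `μ`
for every `K > 32π²`, then `liminf_{μ ↓ 0} μ·|c'(μ)| ≤ 32π²`: for every `K > 32π²` and
every `ε > 0` there is a point of differentiability `μ ∈ (0, ε)` with `μ·|c'(μ)| ≤ K`. -/
theorem liminf_entropy_bound (μ₀ : ℝ) (hμ₀ : 0 < μ₀) (c : ℝ → ℝ)
    (hmono : AntitoneOn c (Set.Ioc 0 μ₀))
    (hbound : ∀ K : ℝ, 32 * π ^ 2 < K → ∃ lamK ∈ Set.Ioo 0 μ₀,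
      ∀ μ ∈ Set.Ioo (0 : ℝ) lamK, c μ ≤ K * Real.log (1 / μ)) :
    ∀ K : ℝ, 32 * π ^ 2 < K → ∀ ε : ℝ, 0 < ε →
      ∃ μ : ℝ, 0 < μ ∧ μ < ε ∧ μ < μ₀ ∧
        DifferentiableAt ℝ c μ ∧ μ * |deriv c μ| ≤ K := by
  intro K hK ε hε
  by_contra! hcon
  obtain ⟨K', hK', hK'K⟩ := exists_between hK
  obtain ⟨lam, hlam, hle⟩ := hbound K' hK'
  obtain ⟨b, hb0, hb⟩ := exists_between (lt_min hε hμ₀)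
  obtain ⟨hbε, hbμ⟩ := lt_min_iff.1 hb
  have hev := tendsto_log_nhdsGT_zero.eventually_lt_atBot ((K * log b + c b) / (K - K'))
  obtain ⟨a, hlog, ha0, ha⟩ :=
    (hev.and (Ioo_mem_nhdsGT (lt_min hb0 hlam.1))).exists
  obtain ⟨hab, halam⟩ := lt_min_iff.1 ha
  have hdrop := AntitoneOn.mul_log_sub_log_le (K := K) ha0 hab.le
    (hmono.mono fun x hx => ⟨ha0.trans_le hx.1, hx.2.trans hbμ.le⟩)
    fun x hx hd => (hcon x (ha0.trans hx.1) (hx.2.trans hbε) (hx.2.trans hbμ) hd).le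
  have hupper := hle a ⟨ha0, halam⟩
  rw [one_div, log_inv] at hupper
  rw [lt_div_iff₀ (sub_pos.2 hK'K)] at hlog
  linarith
end

section
/- For all real numbers K > K₁ > 0, C' > 0 and C̄ ∈ ℝ there exists λ* ∈ (0,1) such that for every λ ∈ (0, λ*): sup_{s > 0} [ (K₁·s²/4)·log(1/λ) − C'·λ^{8−4s} + C̄ ] ≤ K·log(1/λ). -/
open Real

/-- A quadratic minus an exponential is bounded above on the half-line `u ≥ 0`. -/
lemma quadratic_sub_exp_le {a c u : ℝ} (ha : 0 < a) (hc : 0 < c) (hu : 0 ≤ u) :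
    a * (u + u ^ 2) - c * exp (4 * u) ≤
      a * ((1 + 2 * a / c) + (1 + 2 * a / c) ^ 2) := by
  have hA : 0 < 2 * a / c := by positivity
  rcases le_total u (1 + 2 * a / c) with h | h
  · have hexp : 0 ≤ c * exp (4 * u) := by positivity
    have : a * (u + u ^ 2) ≤ a * ((1 + 2 * a / c) + (1 + 2 * a / c) ^ 2) := by gcongr
    linarith
  · have hcube : u ^ 3 ≤ exp (4 * u) := by
      have := Real.pow_div_factorial_le_exp (4 * u) (by positivity) 3
      norm_num [Nat.factorial] at this
      nlinarith [pow_nonneg hu 3]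
    have hcu : 2 * a ≤ c * u := by
      have : 2 * a / c ≤ u := by linarith
      rw [div_le_iff₀ hc] at this
      linarith
    have hquad : u + u ^ 2 ≤ 2 * u ^ 2 := by nlinarith
    have h₁ : a * (u + u ^ 2) ≤ a * (2 * u ^ 2) := by gcongr
    have h₂ : 2 * a * u ^ 2 ≤ c * u * u ^ 2 := by gcongr
    have h₃ : c * u ^ 3 ≤ c * exp (4 * u) := by gcongr
    have h₄ : 0 ≤ a * ((1 + 2 * a / c) + (1 + 2 * a / c) ^ 2) := by positivity
    linarith

/-- For all `K > K₁ > 0`, `C' > 0` and `C̄ ∈ ℝ` there exists `λ* ∈ (0,1)` such that for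
every `λ ∈ (0, λ*)`:
`sup_{s > 0} [ (K₁ s²/4) log(1/λ) − C' λ^{8−4s} + C̄ ] ≤ K log(1/λ)`. -/
theorem mountain_pass_level_log_bound
    (K K₁ C' C₂ : ℝ) (hK₁ : 0 < K₁) (hKK : K₁ < K) (hC' : 0 < C') :
    ∃ lamStar ∈ Set.Ioo (0 : ℝ) 1, ∀ l ∈ Set.Ioo (0 : ℝ) lamStar, ∀ s : ℝ, 0 < s →
      K₁ * s ^ 2 / 4 * Real.log (1 / l) - C' * l ^ (8 - 4 * s) + C₂ ≤
        K * Real.log (1 / l) := by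
  set M := K₁ * ((1 + 2 * K₁ / C') + (1 + 2 * K₁ / C') ^ 2) with hM
  have hM₀ : 0 ≤ M := by positivity
  have hd : 0 < K - K₁ := sub_pos.2 hKK
  have hB : 0 ≤ (M + |C₂|) / (K - K₁) := by positivity
  refine ⟨exp (-(1 + (M + |C₂|) / (K - K₁))), ⟨exp_pos _, exp_lt_one_iff.2 (by linarith)⟩, ?_⟩
  rintro l ⟨hl, hl'⟩ s hs
  have hlog := (Real.log_lt_iff_lt_exp hl).2 hl'
  rw [rpow_def_of_pos hl, one_div, Real.log_inv]
  obtain ⟨L, hL⟩ : ∃ L, L = -Real.log l := ⟨_, rfl⟩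
  have hpow : Real.log l * (8 - 4 * s) = 4 * ((s - 2) * L) := by rw [hL]; ring
  rw [hpow, ← hL]
  have hL₁ : 1 ≤ L := by linarith
  have hgap : M + |C₂| ≤ L * (K - K₁) := by
    rw [← div_le_iff₀ hd]
    linarith
  have hC₂ := le_abs_self C₂
  rcases le_total s 2 with h | h
  · have hexp : 0 ≤ C' * exp (4 * ((s - 2) * L)) := by positivity
    have hsq : K₁ * s ^ 2 / 4 * L ≤ K₁ * L := by
      have hs₄ : s ^ 2 ≤ 4 := by nlinarith
      have : K₁ * s ^ 2 / 4 ≤ K₁ := by nlinarith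
      gcongr
    linarith
  · have hu : 0 ≤ (s - 2) * L := mul_nonneg (by linarith) (by linarith)
    have hbound := quadratic_sub_exp_le hK₁ hC' hu
    have hsq : (s - 2) ^ 2 * L / 4 ≤ ((s - 2) * L) ^ 2 := by
      nlinarith [mul_nonneg (sq_nonneg (s - 2)) (by nlinarith : 0 ≤ L ^ 2 - L / 4)]
    have hmul := mul_le_mul_of_nonneg_left hsq hK₁.le
    linarith
end
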